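/- arXiv:1303.4785 — 3 statements merged into one kernel-verified Lean document; each statement's English description precedes it below -/
import Mathlib

section
/- Einstein addition obeys the right gyroassociative law: for all u, v, w in the c-ball V_c, (u ⊕ v) ⊕ w = u ⊕ (v ⊕ gyr[v,u]w). -/
open scoped RealInnerProductSpace

noncomputable def gamma {V : Type*} [NormedAddCommGroup V] [InnerProductSpace ℝ V]
    (c : ℝ) (u : V) : ℝ :=
  1 / Real.sqrt (1 - ‖u‖ ^ 2 / c ^ 2)

noncomputable def eAdd {V : Type*} [NormedAddCommGroup V] [InnerProductSpace ℝ V]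
    (c : ℝ) (u v : V) : V :=
  (1 / (1 + ⟪u, v⟫ / c ^ 2)) •
    (u + (1 / gamma c u) • v +
      ((1 / c ^ 2) * (gamma c u / (1 + gamma c u)) * ⟪u, v⟫) • u)

noncomputable def eGyr {V : Type*} [NormedAddCommGroup V] [InnerProductSpace ℝ V]
    (c : ℝ) (u v w : V) : V :=
  eAdd c (-(eAdd c u v)) (eAdd c u (eAdd c v w))

noncomputable def eCoadd {V : Type*} [NormedAddCommGroup V] [InnerProductSpace ℝ V]
    (c : ℝ) (u v : V) : V :=
  eAdd c u (eGyr c u (-v) v)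

noncomputable def mAdd {V : Type*} [NormedAddCommGroup V] [InnerProductSpace ℝ V]
    (s : ℝ) (u v : V) : V :=
  (1 / (1 + (2 / s ^ 2) * ⟪u, v⟫ + (1 / s ^ 4) * ‖u‖ ^ 2 * ‖v‖ ^ 2)) •
    ((1 + (2 / s ^ 2) * ⟪u, v⟫ + (1 / s ^ 2) * ‖v‖ ^ 2) • u +
      (1 - (1 / s ^ 2) * ‖u‖ ^ 2) • v)

noncomputable def mGyr {V : Type*} [NormedAddCommGroup V] [InnerProductSpace ℝ V]
    (s : ℝ) (u v w : V) : V :=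
  mAdd s (-(mAdd s u v)) (mAdd s u (mAdd s v w))

noncomputable def mCoadd {V : Type*} [NormedAddCommGroup V] [InnerProductSpace ℝ V]
    (s : ℝ) (u v : V) : V :=
  mAdd s u (mGyr s u (-v) v)

noncomputable def artanh (x : ℝ) : ℝ :=
  (1 / 2) * Real.log ((1 + x) / (1 - x))

open Classical in
noncomputable def sMul {V : Type*} [NormedAddCommGroup V] [InnerProductSpace ℝ V]
    (c : ℝ) (r : ℝ) (v : V) : V :=
  if v = 0 then 0 else (c * Real.tanh (r * artanh (‖v‖ / c)) / ‖v‖) • v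

variable {V : Type*} [NormedAddCommGroup V] [InnerProductSpace ℝ V]

section PointReflection

variable {M : Type*} [AddCommGroup M] [Module ℝ M] (B : LinearMap.BilinForm ℝ M)

/-- The reflection fixing `m` and acting as `-1` on its `B`-orthogonal complement. -/
noncomputable def pointReflection (m : M) : M →ₗ[ℝ] M :=
  (2 / B m m) • (B m).smulRight m - LinearMap.id

theorem pointReflection_apply (m x : M) :
    pointReflection B m x = (2 / B m m * B m x) • m - x := by
  simp [pointReflection, smul_smul]

variable {B}

theorem form_pointReflection (hB : ∀ x y, B x y = B y x) {m : M} (hm : B m m ≠ 0) (x y : M) :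
    B (pointReflection B m x) (pointReflection B m y) = B x y := by
  simp only [pointReflection_apply, map_sub, map_smul, LinearMap.sub_apply, LinearMap.smul_apply,
    smul_eq_mul, hB x m]
  field_simp
  ring

theorem pointReflection_involutive {m : M} (hm : B m m ≠ 0) (x : M) :
    pointReflection B m (pointReflection B m x) = x := by
  have h : 2 / B m m * B m (pointReflection B m x) = 2 / B m m * B m x := by
    simp only [pointReflection_apply, map_sub, map_smul, smul_eq_mul]
    field_simp
    ring
  rw [pointReflection_apply, h, pointReflection_apply]
  abel

theorem pointReflection_conj {g g' : M →ₗ[ℝ] M} (hg : ∀ x y, B (g x) (g y) = B x y)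
    (hgg' : ∀ x, g (g' x) = x) (m x : M) :
    g (pointReflection B m (g' x)) = pointReflection B (g m) x := by
  have h : B m (g' x) = B (g m) x := by rw [← hg, hgg']
  simp only [pointReflection_apply, map_sub, map_smul, hg, hgg', h]

end PointReflection

section Minkowski

variable {V : Type*} [NormedAddCommGroup V] [InnerProductSpace ℝ V]

variable (V) in
/-- The Minkowski form on `ℝ × V` with speed of light `c`. -/
noncomputable def minkowski (c : ℝ) : LinearMap.BilinForm ℝ (ℝ × V) :=
  LinearMap.mk₂ ℝ (fun x y => x.1 * y.1 - ⟪x.2, y.2⟫ / c ^ 2)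
    (fun x y z => by simp only [Prod.fst_add, Prod.snd_add, inner_add_left]; ring)
    (fun r x y => by
      simp only [Prod.smul_fst, Prod.smul_snd, real_inner_smul_left, smul_eq_mul]; ring)
    (fun x y z => by simp only [Prod.fst_add, Prod.snd_add, inner_add_right]; ring)
    (fun r x y => by
      simp only [Prod.smul_fst, Prod.smul_snd, real_inner_smul_right, smul_eq_mul]; ring)

theorem minkowski_apply (c : ℝ) (x y : ℝ × V) :
    minkowski V c x y = x.1 * y.1 - ⟪x.2, y.2⟫ / c ^ 2 := rfl

theorem minkowski_comm (c : ℝ) (x y : ℝ × V) : minkowski V c x y = minkowski V c y x := by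
  rw [minkowski_apply, minkowski_apply, real_inner_comm, mul_comm]

variable (V) in
/-- The unit vector of the time axis. -/
def timeAxis : ℝ × V := (1, 0)

theorem minkowski_timeAxis (c : ℝ) : minkowski V c (timeAxis V) (timeAxis V) = 1 := by
  simp [minkowski_apply, timeAxis]

theorem pointReflection_timeAxis (c : ℝ) (x : ℝ × V) :
    pointReflection (minkowski V c) (timeAxis V) x = (x.1, -x.2) := by
  rw [pointReflection_apply, minkowski_timeAxis]
  ext
  · simp [minkowski_apply, timeAxis]; ring
  · simp [timeAxis]

/-- The unit timelike vector with velocity `u`. -/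
noncomputable def fourVelocity (c : ℝ) (u : V) : ℝ × V := gamma c u • (1, u)

/-- The velocity of a vector of spacetime. -/
noncomputable def velocity (x : ℝ × V) : V := x.1⁻¹ • x.2

/-- The Lorentz boost with velocity `u`, as a product of two point reflections. -/
noncomputable def boost (c : ℝ) (u : V) : (ℝ × V) →ₗ[ℝ] (ℝ × V) :=
  pointReflection (minkowski V c) (fourVelocity c u + timeAxis V) ∘ₗ
    pointReflection (minkowski V c) (timeAxis V)

variable {c : ℝ}

theorem one_sub_norm_sq_div_pos {E : Type*} [SeminormedAddCommGroup E] (hc : 0 < c) {u : E}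
    (hu : ‖u‖ < c) : 0 < 1 - ‖u‖ ^ 2 / c ^ 2 := by
  rw [sub_pos, div_lt_one (by positivity)]
  gcongr

theorem gamma_pos (hc : 0 < c) {u : V} (hu : ‖u‖ < c) : 0 < gamma c u :=
  one_div_pos.2 (Real.sqrt_pos.2 (one_sub_norm_sq_div_pos hc hu))

theorem gamma_sq_mul (hc : 0 < c) {u : V} (hu : ‖u‖ < c) :
    gamma c u ^ 2 * (1 - ‖u‖ ^ 2 / c ^ 2) = 1 := by
  have h := one_sub_norm_sq_div_pos hc hu
  rw [gamma, div_pow, Real.sq_sqrt h.le, one_pow, one_div_mul_cancel h.ne']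

theorem minkowski_fourVelocity (hc : 0 < c) {u : V} (hu : ‖u‖ < c) :
    minkowski V c (fourVelocity c u) (fourVelocity c u) = 1 := by
  rw [← gamma_sq_mul hc hu]
  simp only [fourVelocity, map_smul, LinearMap.smul_apply, smul_eq_mul, minkowski_apply,
    real_inner_self_eq_norm_sq]
  ring

theorem minkowski_fourVelocity_add_timeAxis (hc : 0 < c) {u : V} (hu : ‖u‖ < c) :
    minkowski V c (fourVelocity c u + timeAxis V) (fourVelocity c u + timeAxis V)
      = 2 * (1 + gamma c u) := by
  simp only [map_add, LinearMap.add_apply, minkowski_fourVelocity hc hu, minkowski_timeAxis,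
    minkowski_comm c (timeAxis V)]
  simp [minkowski_apply, fourVelocity, timeAxis]
  ring

theorem minkowski_fourVelocity_add_timeAxis_ne_zero (hc : 0 < c) {u : V} (hu : ‖u‖ < c) :
    minkowski V c (fourVelocity c u + timeAxis V) (fourVelocity c u + timeAxis V) ≠ 0 := by
  rw [minkowski_fourVelocity_add_timeAxis hc hu]
  have := gamma_pos hc hu
  positivity

theorem boost_apply (hc : 0 < c) {u : V} (hu : ‖u‖ < c) (x : ℝ × V) :
    boost c u x = (gamma c u * (x.1 + ⟪u, x.2⟫ / c ^ 2),
      (gamma c u * x.1) • u + x.2 +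
        (gamma c u ^ 2 / (1 + gamma c u) * (⟪u, x.2⟫ / c ^ 2)) • u) := by
  have hγ := gamma_pos hc hu
  have hm : minkowski V c (fourVelocity c u + timeAxis V) (x.1, -x.2)
      = (1 + gamma c u) * x.1 + gamma c u * (⟪u, x.2⟫ / c ^ 2) := by
    simp [minkowski_apply, fourVelocity, timeAxis, real_inner_smul_left]
    ring
  rw [boost, LinearMap.comp_apply, pointReflection_timeAxis, pointReflection_apply,
    minkowski_fourVelocity_add_timeAxis hc hu, hm]
  ext
  · simp [fourVelocity, timeAxis]
    field_simp
    ring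
  · simp only [fourVelocity, timeAxis, Prod.snd_sub, Prod.smul_snd, Prod.snd_add, add_zero,
      smul_smul, sub_neg_eq_add]
    rw [add_right_comm, ← add_smul]
    congr 2
    field_simp

theorem minkowski_boost (hc : 0 < c) {u : V} (hu : ‖u‖ < c) (x y : ℝ × V) :
    minkowski V c (boost c u x) (boost c u y) = minkowski V c x y := by
  simp only [boost, LinearMap.comp_apply]
  rw [form_pointReflection (minkowski_comm c) (minkowski_fourVelocity_add_timeAxis_ne_zero hc hu),
    form_pointReflection (minkowski_comm c) (by simp [minkowski_timeAxis])]

theorem velocity_boost (hc : 0 < c) {u : V} (hu : ‖u‖ < c) {x : ℝ × V} (hx : x.1 ≠ 0) :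
    velocity (boost c u x) = eAdd c u (velocity x) := by
  have hγ := gamma_pos hc hu
  have h : gamma c u * (x.1 + ⟪u, x.2⟫ / c ^ 2)
      = gamma c u * x.1 * (1 + x.1⁻¹ * ⟪u, x.2⟫ / c ^ 2) := by
    field_simp
  simp only [velocity, eAdd, boost_apply hc hu, real_inner_smul_right, h]
  rw [mul_inv, mul_comm, mul_smul, one_div (1 + _)]
  congr 1
  simp only [smul_add, smul_smul]
  congr 2
  · rw [inv_mul_cancel₀ (by positivity), one_smul]
  · congr 1
    field_simp
  · field_simp

theorem norm_velocity_lt_iff {x : ℝ × V} (hx : 0 < x.1) :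
    ‖velocity x‖ < c ↔ ‖x.2‖ < c * x.1 := by
  rw [velocity, norm_smul, norm_inv, Real.norm_of_nonneg hx.le, inv_mul_lt_iff₀ hx, mul_comm]

theorem minkowski_self_pos_iff (hc : 0 < c) {x : ℝ × V} (hx : 0 < x.1) :
    0 < minkowski V c x x ↔ ‖x.2‖ < c * x.1 := by
  rw [minkowski_apply, real_inner_self_eq_norm_sq, sub_pos, div_lt_iff₀ (by positivity),
    ← sq_lt_sq₀ (norm_nonneg _) (by positivity)]
  ring_nf

theorem boost_fst_pos (hc : 0 < c) {u : V} (hu : ‖u‖ < c) {x : ℝ × V} (hx : 0 < x.1)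
    (hx' : 0 < minkowski V c x x) : 0 < (boost c u x).1 := by
  rw [minkowski_self_pos_iff hc hx] at hx'
  rw [boost_apply hc hu]
  refine mul_pos (gamma_pos hc hu) ?_
  have h1 := neg_le_of_abs_le (abs_real_inner_le_norm u x.2)
  have h2 : ‖u‖ * ‖x.2‖ < c * (c * x.1) := mul_lt_mul'' hu hx' (norm_nonneg _) (norm_nonneg _)
  have h3 : x.1 + ⟪u, x.2⟫ / c ^ 2 = (c * (c * x.1) + ⟪u, x.2⟫) / c ^ 2 := by field_simp
  rw [h3]
  exact div_pos (by linarith) (by positivity)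

theorem fourVelocity_velocity {x : ℝ × V} (hx : 0 < x.1)
    (hx' : minkowski V c x x = 1) : fourVelocity c (velocity x) = x := by
  have h : gamma c (velocity x) = x.1 := by
    have h1 : 1 - ‖velocity x‖ ^ 2 / c ^ 2 = (x.1⁻¹) ^ 2 := by
      rw [minkowski_apply, real_inner_self_eq_norm_sq] at hx'
      rw [velocity, norm_smul, norm_inv, Real.norm_of_nonneg hx.le, mul_pow, mul_div_assoc,
        eq_sub_of_add_eq' (sub_eq_iff_eq_add.1 hx').symm]
      field_simp
      ring
    rw [gamma, h1, Real.sqrt_sq (by positivity), one_div, inv_inv]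
  rw [fourVelocity, h, velocity]
  ext
  · simp
  · simp [smul_smul, hx.ne']

theorem fourVelocity_fst_pos (hc : 0 < c) {u : V} (hu : ‖u‖ < c) :
    0 < (fourVelocity c u).1 := by
  simpa [fourVelocity] using gamma_pos hc hu

theorem velocity_fourVelocity (hc : 0 < c) {u : V} (hu : ‖u‖ < c) :
    velocity (fourVelocity c u) = u := by
  simp [velocity, fourVelocity, smul_smul, (gamma_pos hc hu).ne']

theorem norm_eAdd_lt (hc : 0 < c) {u v : V} (hu : ‖u‖ < c) (hv : ‖v‖ < c) :
    ‖eAdd c u v‖ < c := by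
  have hv1 := fourVelocity_fst_pos hc hv
  have hv2 := minkowski_fourVelocity hc hv
  have h := boost_fst_pos hc hu hv1 (hv2 ▸ one_pos)
  rw [← velocity_fourVelocity hc hv, ← velocity_boost hc hu hv1.ne', norm_velocity_lt_iff h,
    ← minkowski_self_pos_iff hc h, minkowski_boost hc hu, hv2]
  exact one_pos

theorem fourVelocity_eAdd (hc : 0 < c) {u v : V} (hu : ‖u‖ < c) (hv : ‖v‖ < c) :
    fourVelocity c (eAdd c u v) = boost c u (fourVelocity c v) := by
  have hv1 := fourVelocity_fst_pos hc hv
  have hv2 := minkowski_fourVelocity hc hv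
  have h := fourVelocity_velocity (boost_fst_pos hc hu hv1 (hv2 ▸ one_pos))
    ((minkowski_boost hc hu _ _).trans hv2)
  rwa [velocity_boost hc hu hv1.ne', velocity_fourVelocity hc hv] at h

theorem boost_timeAxis (hc : 0 < c) {u : V} (hu : ‖u‖ < c) :
    boost c u (timeAxis V) = fourVelocity c u := by
  rw [boost_apply hc hu]
  ext <;> simp [timeAxis, fourVelocity]

theorem boost_neg (c : ℝ) (u : V) (x : ℝ × V) :
    boost c (-u) x = pointReflection (minkowski V c) (timeAxis V)
      (pointReflection (minkowski V c) (fourVelocity c u + timeAxis V) x) := by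
  have ht : minkowski V c (timeAxis V) (timeAxis V) ≠ 0 := by simp [minkowski_timeAxis]
  have h := pointReflection_conj (form_pointReflection (minkowski_comm c) ht)
    (pointReflection_involutive ht) (fourVelocity c u + timeAxis V)
    (pointReflection (minkowski V c) (timeAxis V) x)
  have hm : pointReflection (minkowski V c) (timeAxis V) (fourVelocity c u + timeAxis V)
      = fourVelocity c (-u) + timeAxis V := by
    rw [pointReflection_timeAxis]
    ext <;> simp [fourVelocity, timeAxis, gamma]
  rw [pointReflection_involutive ht, hm] at h
  exact h.symm

theorem boost_eAdd (hc : 0 < c) {u v : V} (hu : ‖u‖ < c) (hv : ‖v‖ < c) (x : ℝ × V) :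
    boost c (eAdd c u v) x
      = boost c u (boost c v (boost c (-eAdd c v u) (boost c v (boost c u x)))) := by
  have ht : minkowski V c (timeAxis V) (timeAxis V) ≠ 0 := by simp [minkowski_timeAxis]
  have hu' := minkowski_fourVelocity_add_timeAxis_ne_zero hc hu
  have hv' := minkowski_fourVelocity_add_timeAxis_ne_zero hc hv
  let P := pointReflection (minkowski V c) (timeAxis V)
  let S (w : V) := pointReflection (minkowski V c) (fourVelocity c w + timeAxis V)
  have hP (y) : P (P y) = y := pointReflection_involutive ht y
  have hSu (y) : S u (S u y) = y := pointReflection_involutive hu' y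
  have hSv (y) : S v (S v y) = y := pointReflection_involutive hv' y
  have hb (w : V) (y) : boost c w y = S w (P y) := rfl
  have hPt : P (timeAxis V) = timeAxis V := by
    simp only [P, pointReflection_timeAxis]
    simp [timeAxis]
  have hS {w : V} (hw : ‖w‖ < c) : S w (timeAxis V) = fourVelocity c w := by
    rw [← boost_timeAxis hc hw, hb, hPt]
  let g := S u ∘ₗ P ∘ₗ S v
  let g' := S v ∘ₗ P ∘ₗ S u
  have hgg' (y) : g (g' y) = y := by simp [g, g', hP, hSu, hSv]
  have hg (y z) : minkowski V c (g y) (g z) = minkowski V c y z := by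
    simp only [g, LinearMap.comp_apply, S, P]
    rw [form_pointReflection (minkowski_comm c) hu', form_pointReflection (minkowski_comm c) ht,
      form_pointReflection (minkowski_comm c) hv']
  have hm : g (fourVelocity c (eAdd c v u) + timeAxis V)
      = fourVelocity c (eAdd c u v) + timeAxis V := by
    have h1 : fourVelocity c (eAdd c v u) = g' (timeAxis V) := by
      rw [fourVelocity_eAdd hc hv hu, hb, ← hS hu]; rfl
    have h2 : fourVelocity c (eAdd c u v) = g (timeAxis V) := by
      rw [fourVelocity_eAdd hc hu hv, hb, ← hS hv]; rfl
    rw [map_add, h1, h2, hgg', add_comm]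
  have h := pointReflection_conj hg hgg' (fourVelocity c (eAdd c v u) + timeAxis V) (P x)
  rw [hm] at h
  rw [boost_neg]
  change S (eAdd c u v) (P x) = S u (P (S v (P (P (S (eAdd c v u) (S v (P (S u (P x)))))))))
  rw [hP]
  exact h.symm

end Minkowski

theorem einstein_right_gyroassociative (c : ℝ) (hc : 0 < c) (u v w : V)
    (hu : ‖u‖ < c) (hv : ‖v‖ < c) (hw : ‖w‖ < c) :
    eAdd c (eAdd c u v) w = eAdd c u (eAdd c v (eGyr c v u w)) := by
  have hp := norm_eAdd_lt hc hu hv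
  have hq : ‖-eAdd c v u‖ < c := by rw [norm_neg]; exact norm_eAdd_lt hc hv hu
  have key {a : V} (ha : ‖a‖ < c) {x : ℝ × V} (hx : 0 < x.1 ∧ 0 < minkowski V c x x) :
      0 < (boost c a x).1 ∧ 0 < minkowski V c (boost c a x) (boost c a x) :=
    ⟨boost_fst_pos hc ha hx.1 hx.2, by rw [minkowski_boost hc ha]; exact hx.2⟩
  have h0 : 0 < (fourVelocity c w).1 ∧
      0 < minkowski V c (fourVelocity c w) (fourVelocity c w) :=
    ⟨fourVelocity_fst_pos hc hw, by rw [minkowski_fourVelocity hc hw]; exact one_pos⟩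
  have h1 := key hu h0
  have h2 := key hv h1
  have h3 := key hq h2
  have h4 := key hv h3
  have h := congrArg velocity (boost_eAdd hc hu hv (fourVelocity c w))
  rwa [velocity_boost hc hp h0.1.ne', velocity_boost hc hu h4.1.ne', velocity_boost hc hv h3.1.ne',
    velocity_boost hc hq h2.1.ne', velocity_boost hc hv h1.1.ne', velocity_boost hc hu h0.1.ne',
    velocity_fourVelocity hc hw] at h
end

section
/- The Two-Sum Identity holds in the Einstein gyrovector space: for all u, v in the c-ball V_c, 2 ⊙ (u ⊕ v) = u ⊕ ((2 ⊙ v) ⊕ u). -/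
open scoped RealInnerProductSpace

variable {V : Type*} [NormedAddCommGroup V] [InnerProductSpace ℝ V]

/-- Every point of the `c`-ball is `(c / a) • x` for a point `(a, x)` of the unit hyperboloid. -/
theorem exists_proper_velocity {c : ℝ} (hc : 0 < c) {u : V} (hu : ‖u‖ < c) :
    ∃ (a : ℝ) (x : V), 0 < a ∧ ‖x‖ ^ 2 = a ^ 2 - 1 ∧ u = (c / a) • x := by
  have h : 0 < 1 - ‖u‖ ^ 2 / c ^ 2 := by
    rw [sub_pos, div_lt_one (by positivity)]
    gcongr
  have hs := Real.sqrt_pos.2 h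
  have hsq := Real.sq_sqrt h.le
  set s := √(1 - ‖u‖ ^ 2 / c ^ 2)
  have hn : ‖u‖ ^ 2 = c ^ 2 * (1 - s ^ 2) := by
    rw [hsq]
    field_simp
    ring
  refine ⟨1 / s, (1 / s / c) • u, by positivity, ?_, ?_⟩
  · rw [norm_smul, mul_pow, Real.norm_eq_abs, sq_abs, hn]
    field_simp
  · match_scalars
    field_simp

theorem gamma_proper_velocity {c a : ℝ} (hc : 0 < c) (ha : 0 < a) {x : V}
    (hx : ‖x‖ ^ 2 = a ^ 2 - 1) : gamma c ((c / a) • x) = a := by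
  have h : 1 - ‖(c / a) • x‖ ^ 2 / c ^ 2 = (1 / a) ^ 2 := by
    rw [norm_smul, mul_pow, Real.norm_eq_abs, sq_abs, hx]
    field_simp
    ring
  rw [gamma, h, Real.sqrt_sq (by positivity), one_div_one_div]

theorem time_add_pos {a b : ℝ} (ha : 0 < a) (hb : 0 < b) {x y : V}
    (hx : ‖x‖ ^ 2 = a ^ 2 - 1) (hy : ‖y‖ ^ 2 = b ^ 2 - 1) : 0 < a * b + ⟪x, y⟫ := by
  have h := neg_le_of_abs_le (abs_real_inner_le_norm x y)
  have hxa : ‖x‖ < a := lt_of_pow_lt_pow_left₀ 2 ha.le (by linarith)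
  have hyb : ‖y‖ < b := lt_of_pow_lt_pow_left₀ 2 hb.le (by linarith)
  have := mul_lt_mul'' hxa hyb (norm_nonneg x) (norm_nonneg y)
  linarith

theorem norm_sq_space_add {a b : ℝ} (ha : 0 < a) {x y : V}
    (hx : ‖x‖ ^ 2 = a ^ 2 - 1) (hy : ‖y‖ ^ 2 = b ^ 2 - 1) :
    ‖(b + ⟪x, y⟫ / (1 + a)) • x + y‖ ^ 2 = (a * b + ⟪x, y⟫) ^ 2 - 1 := by
  have ha' : 1 + a ≠ 0 := by positivity
  rw [norm_add_sq_real, norm_smul, mul_pow, Real.norm_eq_abs, sq_abs, hx, hy, inner_smul_left]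
  simp only [RCLike.conj_to_real]
  field_simp
  ring

/-- Einstein addition in terms of points of the unit hyperboloid. -/
theorem eAdd_proper_velocity {c a b : ℝ} (hc : 0 < c) (ha : 0 < a) (hb : 0 < b) {x y : V}
    (hx : ‖x‖ ^ 2 = a ^ 2 - 1) (hy : ‖y‖ ^ 2 = b ^ 2 - 1) :
    eAdd c ((c / a) • x) ((c / b) • y) =
      (c / (a * b + ⟪x, y⟫)) • ((b + ⟪x, y⟫ / (1 + a)) • x + y) := by
  have ht := (time_add_pos ha hb hx hy).ne'
  have ha' : 1 + a ≠ 0 := by positivity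
  rw [eAdd, gamma_proper_velocity hc ha hx]
  simp only [inner_smul_left, inner_smul_right, RCLike.conj_to_real]
  match_scalars <;> field_simp

theorem norm_sq_double {b : ℝ} {y : V} (hy : ‖y‖ ^ 2 = b ^ 2 - 1) :
    ‖(2 * b) • y‖ ^ 2 = (2 * b ^ 2 - 1) ^ 2 - 1 := by
  rw [norm_smul, mul_pow, Real.norm_eq_abs, sq_abs, hy]
  ring

theorem tanh_two_mul_artanh {z : ℝ} (h₁ : -1 < z) (h₂ : z < 1) :
    Real.tanh (2 * artanh z) = 2 * z / (1 + z ^ 2) := by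
  have hp : 0 < 1 + z := by linarith
  have hm : 0 < 1 - z := by linarith
  rw [artanh, ← mul_assoc, mul_one_div_cancel two_ne_zero, one_mul, Real.tanh_eq_sinh_div_cosh,
    Real.sinh_eq, Real.cosh_eq, Real.exp_neg, Real.exp_log (by positivity)]
  field_simp
  ring

theorem sMul_two_proper_velocity {c b : ℝ} (hc : 0 < c) (hb : 0 < b) {y : V}
    (hy : ‖y‖ ^ 2 = b ^ 2 - 1) :
    sMul c 2 ((c / b) • y) = (c / (2 * b ^ 2 - 1)) • (2 * b) • y := by
  rcases eq_or_ne y 0 with rfl | hy0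
  · simp [sMul]
  have hB : 0 < 2 * b ^ 2 - 1 := by nlinarith [sq_nonneg ‖y‖]
  have hyb : ‖y‖ < b := lt_of_pow_lt_pow_left₀ 2 hb.le (by linarith)
  have hn : 0 < ‖y‖ := norm_pos_iff.2 hy0
  have hnorm : ‖(c / b) • y‖ = c / b * ‖y‖ := by
    rw [norm_smul, Real.norm_of_nonneg (by positivity)]
  have hz : c / b * ‖y‖ / c = ‖y‖ / b := by field_simp
  have hs : 1 + (‖y‖ / b) ^ 2 = (2 * b ^ 2 - 1) / b ^ 2 := by
    rw [div_pow, hy]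
    field_simp
    ring
  rw [sMul, if_neg (smul_ne_zero (by positivity) hy0), hnorm, hz,
    tanh_two_mul_artanh (by linarith [div_pos hn hb]) ((div_lt_one hb).2 hyb), hs, smul_smul,
    smul_smul]
  congr 1
  field_simp

theorem einstein_two_sum_identity (c : ℝ) (hc : 0 < c) (u v : V)
    (hu : ‖u‖ < c) (hv : ‖v‖ < c) :
    sMul c 2 (eAdd c u v) = eAdd c u (eAdd c (sMul c 2 v) u) := by
  obtain ⟨a, x, ha, hx, rfl⟩ := exists_proper_velocity hc hu
  obtain ⟨b, y, hb, hy, rfl⟩ := exists_proper_velocity hc hv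
  have ht := time_add_pos ha hb hx hy
  have hB : 0 < 2 * b ^ 2 - 1 := by nlinarith [sq_nonneg ‖y‖]
  have hY := norm_sq_double hy
  have hT := time_add_pos hB ha hY hx
  have hX := norm_sq_space_add hB hY hx
  rw [eAdd_proper_velocity hc ha hb hx hy,
    sMul_two_proper_velocity hc ht (norm_sq_space_add ha hx hy),
    sMul_two_proper_velocity hc hb hy, eAdd_proper_velocity hc hB ha hY hx,
    eAdd_proper_velocity hc ha hT hx hX]
  have hp : ⟪(2 * b) • y, x⟫ = 2 * b * ⟪x, y⟫ := by
    rw [real_inner_smul_left, real_inner_comm]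
  have hr : (a + ⟪(2 * b) • y, x⟫ / (1 + (2 * b ^ 2 - 1))) • (2 * b) • y + x =
      (2 * (a * b + ⟪x, y⟫)) • y + x := by
    rw [hp, smul_smul, add_sub_cancel]
    congr 2
    field_simp
  have hq : ⟪x, (2 * (a * b + ⟪x, y⟫)) • y + x⟫ =
      2 * (a * b + ⟪x, y⟫) * ⟪x, y⟫ + (a ^ 2 - 1) := by
    rw [inner_add_right, real_inner_smul_right, real_inner_self_eq_norm_sq, hx]
  have htime : a * ((2 * b ^ 2 - 1) * a + 2 * b * ⟪x, y⟫) +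
      (2 * (a * b + ⟪x, y⟫) * ⟪x, y⟫ + (a ^ 2 - 1)) = 2 * (a * b + ⟪x, y⟫) ^ 2 - 1 := by
    ring
  have ha' : 1 + a ≠ 0 := by positivity
  rw [hr, hq, hp, htime]
  congr 1
  match_scalars
  · field_simp
    ring
  · ring
end

section
/- (Euclidean straight lines in Möbius gyrovector spaces) Let A, B be two distinct points of the c-ball V_c. Define P(t) = (½ ⊙ A) ⊞_M {(½ ⊙ A) ⊕_M ([⊖_M(½ ⊙ A) ⊕_M (B ⊖_M (½ ⊙ A))] ⊙ t)} for t ∈ ℝ. Then (i) P(t) = A ⊕_E ((⊖_E A ⊕_E B) ⊙ t) for all t ∈ ℝ, where ⊕_E is Einstein addition on V_c; and (ii) P(0) = A, P(1) = B, and for every t ∈ ℝ there exists λ ∈ ℝ with P(t) = A + λ·(B − A), so the curve P traces the Euclidean straight line through A and B. -/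
open scoped RealInnerProductSpace

variable {V : Type*} [NormedAddCommGroup V] [InnerProductSpace ℝ V]

theorem mobius_denom_pos {c : ℝ} (u v : V) (hu : ‖u‖ < c) (hv : ‖v‖ < c) :
    0 < (c ^ 2) ^ 2 + 2 * c ^ 2 * ⟪u, v⟫ + ‖u‖ ^ 2 * ‖v‖ ^ 2 := by
  have h1 := (abs_le.1 (abs_real_inner_le_norm u v)).1
  have h2 : ‖u‖ * ‖v‖ < c ^ 2 := by
    nlinarith [norm_nonneg u, norm_nonneg v]
  nlinarith [sq_pos_of_pos (sub_pos.2 h2),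
    mul_nonneg (sq_nonneg c) (by linarith : 0 ≤ ⟪u, v⟫ + ‖u‖ * ‖v‖)]

theorem norm_sq_smul_add_smul (m n : ℝ) (u v : V) :
    ‖m • u + n • v‖ ^ 2 = m ^ 2 * ‖u‖ ^ 2 + 2 * m * n * ⟪u, v⟫ + n ^ 2 * ‖v‖ ^ 2 := by
  rw [norm_add_sq_real, norm_smul, norm_smul, mul_pow, mul_pow, inner_smul_left, inner_smul_right,
    Real.norm_eq_abs, Real.norm_eq_abs, sq_abs, sq_abs]
  simp only [conj_trivial]
  ring

theorem mAdd_eq {c : ℝ} (hc : 0 < c) (u v : V) :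
    mAdd c u v = (1 / ((c ^ 2) ^ 2 + 2 * c ^ 2 * ⟪u, v⟫ + ‖u‖ ^ 2 * ‖v‖ ^ 2)) •
      ((c ^ 2 * (c ^ 2 + 2 * ⟪u, v⟫ + ‖v‖ ^ 2)) • u + (c ^ 2 * (c ^ 2 - ‖u‖ ^ 2)) • v) := by
  have h : 1 + (2 / c ^ 2) * ⟪u, v⟫ + (1 / c ^ 4) * ‖u‖ ^ 2 * ‖v‖ ^ 2 =
      ((c ^ 2) ^ 2 + 2 * c ^ 2 * ⟪u, v⟫ + ‖u‖ ^ 2 * ‖v‖ ^ 2) / c ^ 4 := by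
    field_simp
  unfold mAdd
  rw [h, one_div_div, div_eq_mul_one_div]
  match_scalars <;> field_simp

theorem norm_sq_mAdd {c : ℝ} (hc : 0 < c) (u v : V) (hu : ‖u‖ < c) (hv : ‖v‖ < c) :
    ‖mAdd c u v‖ ^ 2 = (c ^ 2) ^ 2 * (‖u‖ ^ 2 + 2 * ⟪u, v⟫ + ‖v‖ ^ 2) /
      ((c ^ 2) ^ 2 + 2 * c ^ 2 * ⟪u, v⟫ + ‖u‖ ^ 2 * ‖v‖ ^ 2) := by
  have hD := mobius_denom_pos u v hu hv
  rw [mAdd_eq hc, norm_smul, mul_pow, norm_sq_smul_add_smul, Real.norm_eq_abs, sq_abs]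
  generalize ‖u‖ ^ 2 = U at *
  generalize ‖v‖ ^ 2 = W at *
  generalize ⟪u, v⟫ = p at *
  generalize c ^ 2 = C at *
  obtain ⟨D, hDe⟩ : ∃ D, D = C ^ 2 + 2 * C * p + U * W := ⟨_, rfl⟩
  rw [← hDe] at hD ⊢
  field_simp
  subst D
  ring

theorem norm_mAdd_lt {c : ℝ} (hc : 0 < c) (u v : V) (hu : ‖u‖ < c) (hv : ‖v‖ < c) :
    ‖mAdd c u v‖ < c := by
  refine lt_of_pow_lt_pow_left₀ 2 hc.le ?_
  rw [norm_sq_mAdd hc u v hu hv, div_lt_iff₀ (mobius_denom_pos u v hu hv)]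
  have h1 : ‖u‖ ^ 2 < c ^ 2 := by gcongr
  have h2 : ‖v‖ ^ 2 < c ^ 2 := by gcongr
  nlinarith [mul_pos (pow_pos hc 2) (mul_pos (sub_pos.2 h1) (sub_pos.2 h2))]

theorem mAdd_zero {c : ℝ} (hc : 0 < c) (u : V) : mAdd c u 0 = u := by
  rw [mAdd_eq hc]
  simp only [inner_zero_right, norm_zero, smul_zero, add_zero, smul_smul]
  convert one_smul ℝ u using 2
  field_simp
  simp

theorem mAdd_neg_self {c : ℝ} (hc : 0 < c) (u : V) : mAdd c (-u) u = 0 := by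
  rw [mAdd_eq hc]
  simp only [inner_neg_left, real_inner_self_eq_norm_sq, norm_neg]
  match_scalars
  ring

theorem mGyr_neg_self {c : ℝ} (hc : 0 < c) (u v : V) (hu : ‖u‖ < c) (hv : ‖v‖ < c) :
    mGyr c u (-v) v = (1 / ((c ^ 2) ^ 2 - 2 * c ^ 2 * ⟪u, v⟫ + ‖u‖ ^ 2 * ‖v‖ ^ 2)) •
      ((-2 * ‖v‖ ^ 2 * (c ^ 2 - ⟪u, v⟫)) • u + ((c ^ 2) ^ 2 - ‖u‖ ^ 2 * ‖v‖ ^ 2) • v) := by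
  have hv' : ‖-v‖ < c := by rwa [norm_neg]
  have hD := mobius_denom_pos u (-v) hu hv'
  have hN := norm_sq_mAdd hc u (-v) hu hv'
  have hI : ⟪mAdd c u (-v), u⟫ = c ^ 2 * ((c ^ 2 - 2 * ⟪u, v⟫ + ‖v‖ ^ 2) * ‖u‖ ^ 2 -
      (c ^ 2 - ‖u‖ ^ 2) * ⟪u, v⟫) /
      ((c ^ 2) ^ 2 - 2 * c ^ 2 * ⟪u, v⟫ + ‖u‖ ^ 2 * ‖v‖ ^ 2) := by
    rw [mAdd_eq hc]
    simp only [inner_add_left, inner_smul_left, inner_neg_left, inner_neg_right, conj_trivial,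
      real_inner_self_eq_norm_sq, real_inner_comm u v, norm_neg]
    ring
  have hu2 : 0 < c ^ 2 - ‖u‖ ^ 2 := by
    have : ‖u‖ ^ 2 < c ^ 2 := by gcongr
    linarith
  have hC : 0 < c ^ 2 := by positivity
  unfold mGyr
  rw [mAdd_neg_self hc, mAdd_zero hc, mAdd_eq hc (-(mAdd c u (-v))), norm_neg, inner_neg_left, hN,
    hI, mAdd_eq hc u (-v)]
  simp only [inner_neg_right, norm_neg] at hD ⊢
  generalize ‖u‖ ^ 2 = U at *
  generalize ‖v‖ ^ 2 = W at *
  generalize ⟪u, v⟫ = p at *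
  generalize c ^ 2 = C at *
  have hD' : 0 < C ^ 2 - 2 * C * p + U * W := by linarith
  obtain ⟨D, hDe⟩ : ∃ D, D = C ^ 2 - 2 * C * p + U * W := ⟨_, rfl⟩
  rw [← hDe] at hD' ⊢
  have e1 : C ^ 2 + 2 * C * -p + U * W = D := by rw [hDe]; ring
  rw [e1]
  have e2 : C ^ 2 + 2 * C * -(C * ((C - 2 * p + W) * U - (C - U) * p) / D) +
      C ^ 2 * (U + 2 * -p + W) / D * U = C ^ 2 * (C - U) ^ 2 / D := by
    field_simp
    subst D
    ring
  rw [e2]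
  match_scalars <;> (field_simp; subst D; ring)

theorem mCoadd_eq {c : ℝ} (hc : 0 < c) (u v : V) (hu : ‖u‖ < c) (hv : ‖v‖ < c) :
    mCoadd c u v = (c ^ 2 / ((c ^ 2) ^ 2 - ‖u‖ ^ 2 * ‖v‖ ^ 2)) •
      ((c ^ 2 - ‖v‖ ^ 2) • u + (c ^ 2 - ‖u‖ ^ 2) • v) := by
  have hD := mobius_denom_pos u (-v) hu (by rwa [norm_neg])
  have hE : 0 < (c ^ 2) ^ 2 - ‖u‖ ^ 2 * ‖v‖ ^ 2 := by
    have h1 : ‖u‖ ^ 2 < c ^ 2 := by gcongr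
    have h2 : ‖v‖ ^ 2 < c ^ 2 := by gcongr
    nlinarith [sq_nonneg ‖u‖, sq_nonneg ‖v‖]
  unfold mCoadd
  rw [mGyr_neg_self hc u v hu hv, mAdd_eq hc, norm_smul, mul_pow, norm_sq_smul_add_smul,
    Real.norm_eq_abs, sq_abs]
  simp only [inner_add_right, inner_smul_right, inner_neg_right, real_inner_self_eq_norm_sq,
    norm_neg] at hD ⊢
  generalize ‖u‖ ^ 2 = U at *
  generalize ‖v‖ ^ 2 = W at *
  generalize ⟪u, v⟫ = p at *
  generalize c ^ 2 = C at *
  have hD' : 0 < C ^ 2 - 2 * C * p + U * W := by linarith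
  obtain ⟨D, hDe⟩ : ∃ D, D = C ^ 2 - 2 * C * p + U * W := ⟨_, rfl⟩
  rw [← hDe] at hD' ⊢
  have e1 : (1 / D) ^ 2 * ((-2 * W * (C - p)) ^ 2 * U +
      2 * (-2 * W * (C - p)) * (C ^ 2 - U * W) * p + (C ^ 2 - U * W) ^ 2 * W) = W := by
    field_simp
    subst D
    ring
  have e2 : C ^ 2 + 2 * C * (1 / D *
      (-2 * W * (C - p) * U + (C ^ 2 - U * W) * p)) + U * W =
      (C ^ 2 - U * W) ^ 2 / D := by
    field_simp
    subst D
    ring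
  rw [e1, e2]
  match_scalars <;> field_simp
  subst D
  ring

/-- Einstein addition `(2 ⊙ a) ⊕ x`, expressed through `a`. -/
noncomputable def doubleAdd (c : ℝ) (a x : V) : V :=
  (1 / (c ^ 2 + ‖a‖ ^ 2 + 2 * ⟪a, x⟫)) •
    ((2 * (c ^ 2 + ⟪a, x⟫)) • a + (c ^ 2 - ‖a‖ ^ 2) • x)

theorem doubleAdd_denom_pos {c : ℝ} (a x : V) (ha : ‖a‖ < c) (hx : ‖x‖ < c) :
    0 < c ^ 2 + ‖a‖ ^ 2 + 2 * ⟪a, x⟫ := by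
  have h1 := (abs_le.1 (abs_real_inner_le_norm a x)).1
  nlinarith [norm_nonneg a, norm_nonneg x, sq_pos_of_pos (sub_pos.2 ha),
    mul_nonneg (norm_nonneg a) (sub_pos.2 hx).le]

theorem mCoadd_mAdd {c : ℝ} (hc : 0 < c) (a x : V) (ha : ‖a‖ < c) (hx : ‖x‖ < c) :
    mCoadd c a (mAdd c a x) = doubleAdd c a x := by
  have hD := mobius_denom_pos a x ha hx
  have hF := doubleAdd_denom_pos a x ha hx
  have ha2 : 0 < c ^ 2 - ‖a‖ ^ 2 := by
    have : ‖a‖ ^ 2 < c ^ 2 := by gcongr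
    linarith
  have hC : 0 < c ^ 2 := by positivity
  rw [mCoadd_eq hc a _ ha (norm_mAdd_lt hc a x ha hx), norm_sq_mAdd hc a x ha hx, mAdd_eq hc a x]
  unfold doubleAdd
  generalize ‖a‖ ^ 2 = U at *
  generalize ‖x‖ ^ 2 = W at *
  generalize ⟪a, x⟫ = p at *
  generalize c ^ 2 = C at *
  obtain ⟨D, hDe⟩ : ∃ D, D = C ^ 2 + 2 * C * p + U * W := ⟨_, rfl⟩
  rw [← hDe] at hD ⊢
  have e : C ^ 2 - U * (C ^ 2 * (U + 2 * p + W) / D) =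
      C ^ 2 * ((C - U) * (C + U + 2 * p)) / D := by
    field_simp
    subst D
    ring
  rw [e]
  match_scalars <;> field_simp
  subst D
  ring

theorem mAdd_mAdd_self {c : ℝ} (hc : 0 < c) (a x : V) (ha : ‖a‖ < c) (hx : ‖x‖ < c) :
    mAdd c a (mAdd c x a) = doubleAdd c a x := by
  have hD := mobius_denom_pos x a hx ha
  have hF := doubleAdd_denom_pos a x ha hx
  have hG := mobius_denom_pos a _ ha (norm_mAdd_lt hc x a hx ha)
  have hI : ⟪a, mAdd c x a⟫ = c ^ 2 * ((c ^ 2 + 2 * ⟪a, x⟫ + ‖a‖ ^ 2) * ⟪a, x⟫ +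
      (c ^ 2 - ‖x‖ ^ 2) * ‖a‖ ^ 2) /
      ((c ^ 2) ^ 2 + 2 * c ^ 2 * ⟪a, x⟫ + ‖x‖ ^ 2 * ‖a‖ ^ 2) := by
    rw [mAdd_eq hc]
    simp only [inner_add_right, inner_smul_right, real_inner_self_eq_norm_sq, real_inner_comm a x]
    ring
  have hC : 0 < c ^ 2 := by positivity
  rw [mAdd_eq hc a, hI, norm_sq_mAdd hc x a hx ha, mAdd_eq hc x a]
  unfold doubleAdd
  rw [real_inner_comm a x] at *
  generalize ‖a‖ ^ 2 = U at *
  generalize ‖x‖ ^ 2 = W at *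
  generalize ⟪a, x⟫ = p at *
  generalize c ^ 2 = C at *
  obtain ⟨D, hDe⟩ : ∃ D, D = C ^ 2 + 2 * C * p + W * U := ⟨_, rfl⟩
  rw [← hDe] at hD ⊢
  have e : C ^ 2 + 2 * C * (C * ((C + 2 * p + U) * p + (C - W) * U) / D) +
      U * (C ^ 2 * (W + 2 * p + U) / D) =
      C ^ 2 * (C + U + 2 * p) ^ 2 / D := by
    field_simp
    subst D
    ring
  rw [e]
  match_scalars <;> (field_simp; subst D; ring)

theorem eAdd_double {c : ℝ} (hc : 0 < c) (a x : V) (ha : ‖a‖ < c) (hx : ‖x‖ < c) :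
    eAdd c ((2 * c ^ 2 / (c ^ 2 + ‖a‖ ^ 2)) • a) x = doubleAdd c a x := by
  have hF := doubleAdd_denom_pos a x ha hx
  have ha2 : 0 < c ^ 2 - ‖a‖ ^ 2 := by
    have : ‖a‖ ^ 2 < c ^ 2 := by gcongr
    linarith
  have hC : 0 < c ^ 2 := by positivity
  have hS : 0 < c ^ 2 + ‖a‖ ^ 2 := by positivity
  have hg : gamma c ((2 * c ^ 2 / (c ^ 2 + ‖a‖ ^ 2)) • a) =
      (c ^ 2 + ‖a‖ ^ 2) / (c ^ 2 - ‖a‖ ^ 2) := by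
    unfold gamma
    have : 1 - ‖(2 * c ^ 2 / (c ^ 2 + ‖a‖ ^ 2)) • a‖ ^ 2 / c ^ 2 =
        ((c ^ 2 - ‖a‖ ^ 2) / (c ^ 2 + ‖a‖ ^ 2)) ^ 2 := by
      rw [norm_smul, mul_pow, Real.norm_eq_abs, sq_abs]
      field_simp
      ring
    rw [this, Real.sqrt_sq (by positivity), one_div_div]
  unfold eAdd doubleAdd
  rw [hg, inner_smul_left, conj_trivial]
  generalize ‖a‖ ^ 2 = U at *
  generalize ⟪a, x⟫ = p at *
  generalize c ^ 2 = C at *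
  have e1 : 1 + 2 * C / (C + U) * p / C = (C + U + 2 * p) / (C + U) := by
    field_simp
  have e2 : 1 + (C + U) / (C - U) = 2 * C / (C - U) := by
    field_simp
    ring
  rw [e1, e2]
  match_scalars <;> field_simp

theorem doubleAdd_zero {c : ℝ} (a : V) :
    doubleAdd c a 0 = (2 * c ^ 2 / (c ^ 2 + ‖a‖ ^ 2)) • a := by
  unfold doubleAdd
  simp only [inner_zero_right, mul_zero, add_zero, smul_zero, smul_smul]
  congr 1
  ring

/-- The image of the ray through `(-2 ⊙ a) ⊕ B` stays on the line through `2 ⊙ a` and `B`. -/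
theorem doubleAdd_smul_neg {c : ℝ} (hc : 0 < c) (a B : V) (ha : ‖a‖ < c) (hB : ‖B‖ < c) (k : ℝ)
    (hk : ‖k • doubleAdd c (-a) B‖ < c) :
    doubleAdd c a (k • doubleAdd c (-a) B) =
      (2 * c ^ 2 / (c ^ 2 + ‖a‖ ^ 2)) • a +
        (k * (c ^ 2 - ‖a‖ ^ 2) ^ 2 / ((c ^ 2 + ‖a‖ ^ 2 - 2 * ⟪a, B⟫) *
          (c ^ 2 + ‖a‖ ^ 2 + 2 * ⟪a, k • doubleAdd c (-a) B⟫))) •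
          (B - (2 * c ^ 2 / (c ^ 2 + ‖a‖ ^ 2)) • a) := by
  have hF := doubleAdd_denom_pos (-a) B (by rwa [norm_neg]) hB
  have hG := doubleAdd_denom_pos a _ ha hk
  have hC : 0 < c ^ 2 := by positivity
  have hS : 0 < c ^ 2 + ‖a‖ ^ 2 := by positivity
  have hI : ⟪a, k • doubleAdd c (-a) B⟫ = k * ((-2 * (c ^ 2 - ⟪a, B⟫) * ‖a‖ ^ 2 +
      (c ^ 2 - ‖a‖ ^ 2) * ⟪a, B⟫) / (c ^ 2 + ‖a‖ ^ 2 - 2 * ⟪a, B⟫)) := by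
    unfold doubleAdd
    simp only [inner_add_right, inner_smul_right, inner_neg_left, inner_neg_right,
      real_inner_self_eq_norm_sq, norm_neg]
    ring
  rw [doubleAdd]
  generalize ⟪a, k • doubleAdd c (-a) B⟫ = p at *
  unfold doubleAdd
  simp only [inner_neg_left, norm_neg] at hF ⊢
  generalize ‖a‖ ^ 2 = U at *
  generalize ⟪a, B⟫ = q at *
  generalize c ^ 2 = C at *
  have hF' : 0 < C + U - 2 * q := by linarith
  have e : C + U + 2 * -q = C + U - 2 * q := by ring
  rw [e]
  rw [eq_comm, ← mul_div_assoc, div_eq_iff hF'.ne'] at hI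
  match_scalars
  · field_simp
    linear_combination (C - U) * hI
  · field_simp

theorem doubleAdd_neg_cancel {c : ℝ} (hc : 0 < c) (a B : V) (ha : ‖a‖ < c) (hB : ‖B‖ < c)
    (hw : ‖doubleAdd c (-a) B‖ < c) : doubleAdd c a (doubleAdd c (-a) B) = B := by
  have h := doubleAdd_smul_neg hc a B ha hB 1 (by rwa [one_smul])
  have hF := doubleAdd_denom_pos (-a) B (by rwa [norm_neg]) hB
  have hG := doubleAdd_denom_pos a _ ha hw
  have hI : ⟪a, doubleAdd c (-a) B⟫ = ((-2 * (c ^ 2 - ⟪a, B⟫) * ‖a‖ ^ 2 +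
      (c ^ 2 - ‖a‖ ^ 2) * ⟪a, B⟫) / (c ^ 2 + ‖a‖ ^ 2 - 2 * ⟪a, B⟫)) := by
    unfold doubleAdd
    simp only [inner_add_right, inner_smul_right, inner_neg_left, inner_neg_right,
      real_inner_self_eq_norm_sq, norm_neg]
    ring
  simp only [inner_neg_left, norm_neg] at hF
  have hF' : 0 < c ^ 2 + ‖a‖ ^ 2 - 2 * ⟪a, B⟫ := by linarith
  have e : 1 * (c ^ 2 - ‖a‖ ^ 2) ^ 2 / ((c ^ 2 + ‖a‖ ^ 2 - 2 * ⟪a, B⟫) *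
      (c ^ 2 + ‖a‖ ^ 2 + 2 * ⟪a, doubleAdd c (-a) B⟫)) = 1 := by
    rw [div_eq_one_iff_eq (by positivity), hI, mul_add, mul_left_comm _ (2 : ℝ),
      mul_div_cancel₀ _ hF'.ne']
    ring
  rw [one_smul] at h
  rw [h, e, one_smul, add_sub_cancel]

theorem tanh_artanh {x : ℝ} (h1 : -1 < x) (h2 : x < 1) : Real.tanh (artanh x) = x := by
  have hp : 0 < (1 + x) / (1 - x) := div_pos (by linarith) (by linarith)
  have hy : 2 * artanh x = Real.log ((1 + x) / (1 - x)) := by unfold artanh; ring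
  have he : Real.exp (artanh x) ^ 2 = (1 + x) / (1 - x) := by
    rw [← Real.exp_nat_mul, Nat.cast_ofNat, hy, Real.exp_log hp]
  have h0 := Real.exp_pos (artanh x)
  rw [eq_div_iff (by linarith)] at he
  rw [Real.tanh_eq, Real.exp_neg]
  field_simp
  linear_combination he

theorem tanh_eq_half (y : ℝ) :
    Real.tanh y = 2 * Real.tanh (1 / 2 * y) / (1 + Real.tanh (1 / 2 * y) ^ 2) := by
  have h0 := Real.exp_pos (1 / 2 * y)
  have hy : Real.exp y = Real.exp (1 / 2 * y) ^ 2 := by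
    rw [← Real.exp_nat_mul]
    congr 1
    push_cast
    ring
  rw [Real.tanh_eq, Real.tanh_eq, Real.exp_neg, Real.exp_neg, hy]
  field_simp
  ring

theorem norm_sMul {c : ℝ} (hc : 0 < c) (r : ℝ) (v : V) (hv : v ≠ 0) :
    ‖sMul c r v‖ = c * |Real.tanh (r * artanh (‖v‖ / c))| := by
  have : 0 < ‖v‖ := norm_pos_iff.2 hv
  rw [sMul, if_neg hv, norm_smul, Real.norm_eq_abs, abs_div, abs_mul, abs_of_pos hc, abs_norm]
  field_simp

theorem norm_sMul_lt {c : ℝ} (hc : 0 < c) (r : ℝ) (v : V) : ‖sMul c r v‖ < c := by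
  by_cases hv : v = 0
  · simpa [sMul, hv] using hc
  · rw [norm_sMul hc r v hv]
    exact mul_lt_of_lt_one_right hc (Real.abs_tanh_lt_one _)

theorem exists_sMul_eq_smul (c r : ℝ) (v : V) : ∃ k : ℝ, sMul c r v = k • v := by
  by_cases hv : v = 0
  · exact ⟨0, by simp [sMul, hv]⟩
  · exact ⟨_, by rw [sMul, if_neg hv]⟩

theorem sMul_zero (c : ℝ) (v : V) : sMul c 0 v = 0 := by
  simp [sMul]

theorem tanh_artanh_div {c x : ℝ} (hc : 0 < c) (hx : 0 ≤ x) (hxc : x < c) :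
    Real.tanh (artanh (x / c)) = x / c :=
  tanh_artanh (neg_one_lt_zero.trans_le (by positivity)) ((div_lt_one hc).2 hxc)

theorem sMul_one {c : ℝ} (hc : 0 < c) (v : V) (hv : ‖v‖ < c) : sMul c 1 v = v := by
  by_cases h : v = 0
  · simp [sMul, h]
  · have : 0 < ‖v‖ := norm_pos_iff.2 h
    rw [sMul, if_neg h, one_mul, tanh_artanh_div hc (norm_nonneg v) hv]
    convert one_smul ℝ v using 2
    field_simp

theorem double_sMul_half {c : ℝ} (hc : 0 < c) (v : V) (hv : ‖v‖ < c) :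
    (2 * c ^ 2 / (c ^ 2 + ‖sMul c (1 / 2) v‖ ^ 2)) • sMul c (1 / 2) v = v := by
  by_cases h : v = 0
  · simp [sMul, h]
  · have h0 : 0 < ‖v‖ := norm_pos_iff.2 h
    have ht := tanh_eq_half (artanh (‖v‖ / c))
    rw [tanh_artanh_div hc (norm_nonneg v) hv] at ht
    rw [norm_sMul hc _ v h, mul_pow, sq_abs, sMul, if_neg h, smul_smul]
    generalize Real.tanh (1 / 2 * artanh (‖v‖ / c)) = T at *
    convert one_smul ℝ v using 2
    field_simp at ht ⊢
    linear_combination -ht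

theorem euclidean_lines_in_mobius (c : ℝ) (hc : 0 < c) (A B : V)
    (hA : ‖A‖ < c) (hB : ‖B‖ < c) (hAB : A ≠ B)
    (P : ℝ → V)
    (hP : ∀ t : ℝ, P t =
      mCoadd c (sMul c (1 / 2) A)
        (mAdd c (sMul c (1 / 2) A)
          (sMul c t
            (mAdd c (-(sMul c (1 / 2) A))
              (mAdd c B (-(sMul c (1 / 2) A))))))) :
    (∀ t : ℝ, P t = eAdd c A (sMul c t (eAdd c (-A) B))) ∧
    P 0 = A ∧ P 1 = B ∧
    ∀ t : ℝ, ∃ lam : ℝ, P t = A + lam • (B - A) := by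
  set a := sMul c (1 / 2) A
  have ha : ‖a‖ < c := norm_sMul_lt hc _ A
  have ha' : ‖-a‖ < c := by rwa [norm_neg]
  have hAa : (2 * c ^ 2 / (c ^ 2 + ‖a‖ ^ 2)) • a = A := double_sMul_half hc A hA
  have hAa' : (2 * c ^ 2 / (c ^ 2 + ‖-a‖ ^ 2)) • -a = -A := by rw [norm_neg, smul_neg, hAa]
  have hw : mAdd c (-a) (mAdd c B (-a)) = doubleAdd c (-a) B := mAdd_mAdd_self hc (-a) B ha' hB
  have hw_lt : ‖doubleAdd c (-a) B‖ < c := by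
    rw [← hw]
    exact norm_mAdd_lt hc _ _ ha' (norm_mAdd_lt hc _ _ hB ha')
  have hPt : ∀ t, P t = doubleAdd c a (sMul c t (doubleAdd c (-a) B)) := fun t ↦ by
    rw [hP, hw, mCoadd_mAdd hc a _ ha (norm_sMul_lt hc _ _)]
  refine ⟨fun t ↦ ?_, ?_, ?_, fun t ↦ ?_⟩
  · rw [hPt, ← eAdd_double hc a _ ha (norm_sMul_lt hc _ _), hAa,
      ← eAdd_double hc (-a) B ha' hB, hAa']
  · rw [hPt, sMul_zero, doubleAdd_zero, hAa]
  · rw [hPt, sMul_one hc _ hw_lt, doubleAdd_neg_cancel hc a B ha hB hw_lt]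
  · obtain ⟨k, hk⟩ := exists_sMul_eq_smul c t (doubleAdd c (-a) B)
    have hk_lt : ‖k • doubleAdd c (-a) B‖ < c := hk ▸ norm_sMul_lt hc _ _
    exact ⟨_, by rw [hPt, hk, doubleAdd_smul_neg hc a B ha hB k hk_lt, hAa]⟩
end
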